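/- Let L ⊆ V^P be an isotropic subspace, σ a group-homomorphic section over L, and S ⊆ P a subset. Then the Cartesian projection SO(3)^P → SO(3)^S, (g_s)_{s∈P} ↦ (g_s)_{s∈S}, maps A(L,σ) into A(L_S, σ|_{L_S}). -/

import Mathlib

/- Common framework: binary stabilizer codes, local unitary/SO(3) automorphism groups. -/

noncomputable section
open scoped Matrix Real ComplexConjugate
open scoped Classical

namespace Stab

/-- The one-qubit phase space `V = 𝔽₂ ⊕ 𝔽₂`, with first coordinate the `z`-component
and second coordinate the `x`-component. -/
abbrev V : Type := ZMod 2 × ZMod 2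

/-- The symplectic form on `V`. -/
def omegaV (u v : V) : ZMod 2 := u.1 * v.2 + u.2 * v.1

/-- The phase space `V^P` over a set of qubits `P`. -/
abbrev QV (P : Type) := P → V

variable {P : Type} [Fintype P] [DecidableEq P]

/-- The direct-sum symplectic form on `V^P`. -/
def omega (u v : QV P) : ZMod 2 := ∑ p, omegaV (u p) (v p)

/-- A subspace `L ⊆ V^P` is isotropic if `ω` vanishes identically on `L × L`. -/
def Isotropic (L : Submodule (ZMod 2) (QV P)) : Prop := ∀ u ∈ L, ∀ v ∈ L, omega u v = 0

/-- Support of a vector of `V^P`. -/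
def supp (v : QV P) : Set P := {p | v p ≠ 0}

/-- The basis vector `z_p`. -/
def zvec (p : P) : QV P := Pi.single p ((1 : ZMod 2), (0 : ZMod 2))

/-- The basis vector `x_p`. -/
def xvec (p : P) : QV P := Pi.single p ((0 : ZMod 2), (1 : ZMod 2))

/-- Restriction (coordinate projection) of a vector to a subset `S ⊆ P`. -/
def restrTo (S : Set P) (v : QV P) : QV P := fun p => if p ∈ S then v p else 0

/-- The coordinate subspace `V^S ⊆ V^P`. -/
def coordSub (S : Set P) : Submodule (ZMod 2) (QV P) where
  carrier := {v | ∀ p ∉ S, v p = 0}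
  add_mem' := by intro a b ha hb p hp; simp [Pi.add_apply, ha p hp, hb p hp]
  zero_mem' := by intro p _; rfl
  smul_mem' := by intro c a ha p hp; simp [Pi.smul_apply, ha p hp]

/-- `L_S := L ∩ V^S`. -/
def LS (L : Submodule (ZMod 2) (QV P)) (S : Set P) : Submodule (ZMod 2) (QV P) :=
  L ⊓ coordSub S

/-- `L` splits as a direct factor on `S`, i.e. `L = L_S × L_{P∖S}`. -/
def SplitsOn (L : Submodule (ZMod 2) (QV P)) (S : Set P) : Prop :=
  ∀ v ∈ L, restrTo S v ∈ L

/-- `L` splits off a zero factor: on some nonempty `S ⊆ P` all vectors of `L` vanish. -/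
def HasZeroFactor (L : Submodule (ZMod 2) (QV P)) : Prop :=
  ∃ S : Set P, S.Nonempty ∧ ∀ v ∈ L, ∀ p ∈ S, v p = 0

/-- The qubit `p` is trivial: `L` splits off a one-dimensional factor on `{p}`. -/
def TrivialQubit (L : Submodule (ZMod 2) (QV P)) (p : P) : Prop :=
  SplitsOn L {p} ∧ ∃ v ∈ L, v ≠ 0 ∧ supp v ⊆ {p}

/-- `L` splits off a trivial factor. -/
def HasTrivialFactor (L : Submodule (ZMod 2) (QV P)) : Prop :=
  ∃ p : P, TrivialQubit L p

/-- `L` splits off a Bell Lagrangian: an indecomposable Lagrangian direct factor on a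
two-element set of qubits (all of whose nonzero vectors have full support `{p, q}`). -/
def HasBellFactor (L : Submodule (ZMod 2) (QV P)) : Prop :=
  ∃ p q : P, p ≠ q ∧ SplitsOn L {p, q} ∧
    ∃ v ∈ L, ∃ w ∈ L, v ≠ w ∧ supp v = {p, q} ∧ supp w = {p, q} ∧ supp (v + w) = {p, q}

/-- The factor `L_S` (for `S` in a partition) is indecomposable. -/
def IndecompWithin (L : Submodule (ZMod 2) (QV P)) (S : Set P) : Prop :=
  ∀ T ⊆ S, SplitsOn L T → T = ∅ ∨ T = S

/-! ### The Hilbert space, Pauli operators and stabilizer codes -/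

/-- The state space `ℋ^{⊗P} = (ℂ²)^{⊗P}`, realised concretely as functions on
computational basis labels. -/
abbrev HP (P : Type) := (P → Fin 2) → ℂ

/-- Operators on `ℋ^{⊗P}` as matrices. -/
abbrev MatP (P : Type) := Matrix (P → Fin 2) (P → Fin 2) ℂ

/-- The tensor (local) operator `⊗_{p} g_p` on `ℋ^{⊗P}`. -/
def locOp (g : P → Matrix (Fin 2) (Fin 2) ℂ) : MatP P :=
  Matrix.of fun u w => ∏ p, g p (u p) (w p)

def sigmaX : Matrix (Fin 2) (Fin 2) ℂ := !![0, 1; 1, 0]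
def sigmaY : Matrix (Fin 2) (Fin 2) ℂ := !![0, -Complex.I; Complex.I, 0]
def sigmaZ : Matrix (Fin 2) (Fin 2) ℂ := !![1, 0; 0, -1]

/-- The one-qubit Pauli operator `Z^a X^b` attached to `(a, b) ∈ V`. -/
def pauliMat (v : V) : Matrix (Fin 2) (Fin 2) ℂ := sigmaZ ^ (v.1 : ZMod 2).val * sigmaX ^ (v.2 : ZMod 2).val

/-- The Pauli (Weyl) operator attached to `v ∈ V^P`. -/
def Wop (v : QV P) : MatP P := locOp fun p => pauliMat (v p)

/-- A group-homomorphic section `σ` over `L` of the projection from the Pauli group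
`Ṽ^P` onto `V^P`: each value `σ(v)` is a unitary scalar multiple of the Pauli operator
`W(v)`, and `σ` is multiplicative on `L`. -/
structure PauliSection (L : Submodule (ZMod 2) (QV P)) where
  toFun : QV P → MatP P
  scalar : ∀ v : QV P, ∃ c : ℂ, toFun v = c • Wop v
  unitary : ∀ v : QV P, toFun v ∈ Matrix.unitaryGroup (P → Fin 2) ℂ
  mul_of_mem : ∀ u ∈ L, ∀ v ∈ L, toFun (u + v) = toFun u * toFun v
  map_zero : toFun 0 = 1

/-- The stabilizer code `C(L, σ)`: the common fixed-point space of the stabilizer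
group `σ(L)`. -/
def code (L : Submodule (ZMod 2) (QV P)) (σ : PauliSection L) : Submodule ℂ (HP P) where
  carrier := {ψ | ∀ v ∈ L, σ.toFun v *ᵥ ψ = ψ}
  add_mem' := by intro a b ha hb v hv; rw [Matrix.mulVec_add, ha v hv, hb v hv]
  zero_mem' := by intro v hv; simp
  smul_mem' := by intro c a ha v hv; rw [Matrix.mulVec_smul, ha v hv]

/-- The standard section: `σ(v) = W(v)` on `L`. -/
def StandardOn (L : Submodule (ZMod 2) (QV P)) (σ : PauliSection L) : Prop :=
  ∀ v ∈ L, σ.toFun v = Wop v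

/-! ### `SO(3)`, rotations, and the automorphism group of a code -/

/-- `3×3` real matrices. -/
abbrev Rot : Type := Matrix (Fin 3) (Fin 3) ℝ

/-- `SO(3)` as a set of `3×3` real matrices. -/
def SO3 : Set Rot := {A | A * Aᵀ = 1 ∧ A.det = 1}

/-- The ordered Pauli basis (x, y, z) of traceless Hermitian `2×2` matrices. -/
def pauliBasis : Fin 3 → Matrix (Fin 2) (Fin 2) ℂ := ![sigmaX, sigmaY, sigmaZ]

/-- The image of a unitary `u ∈ U(2)` in `SO(3)` under the adjoint action on traceless
Hermitian operators (the identification `U(2)/S¹ = SO(3)`):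
`u σ_j u† = Σ_i (adjRot u)_{ij} σ_i`. -/
def adjRot (u : Matrix (Fin 2) (Fin 2) ℂ) : Rot :=
  Matrix.of fun i j =>
    (1 / 2 : ℝ) * ((pauliBasis i * u * pauliBasis j * u.conjTranspose).trace).re

/-- Rotation about the `x`-axis by angle `θ`. -/
def rotX (θ : ℝ) : Rot := !![1, 0, 0; 0, Real.cos θ, -Real.sin θ; 0, Real.sin θ, Real.cos θ]

/-- Rotation about the `y`-axis by angle `θ`. -/
def rotY (θ : ℝ) : Rot := !![Real.cos θ, 0, Real.sin θ; 0, 1, 0; -Real.sin θ, 0, Real.cos θ]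

/-- Rotation about the `z`-axis by angle `θ`. -/
def rotZ (θ : ℝ) : Rot := !![Real.cos θ, -Real.sin θ, 0; Real.sin θ, Real.cos θ, 0; 0, 0, 1]

/-- The circle group `C_x ⊆ SO(3)` of rotations about the `x`-axis. -/
def Cx : Set Rot := Set.range rotX

/-- The circle group `C_y ⊆ SO(3)` of rotations about the `y`-axis. -/
def Cy : Set Rot := Set.range rotY

/-- The circle group `C_z ⊆ SO(3)` of rotations about the `z`-axis. -/
def Cz : Set Rot := Set.range rotZ

/-- The octahedral group: the subgroup of `SO(3)` generated by the rotations by a right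
angle about the three coordinate axes. -/
def octahedral : Set Rot :=
  (Submonoid.closure {rotX (π / 2), rotY (π / 2), rotZ (π / 2)} : Submonoid Rot)

/-- The infinite dihedral group `D_x ⊆ SO(3)`. -/
def Dx : Set Rot := (Submonoid.closure (Cx ∪ {rotZ π}) : Submonoid Rot)

/-- The infinite dihedral group `D_y ⊆ SO(3)`. -/
def Dy : Set Rot := (Submonoid.closure (Cy ∪ {rotZ π}) : Submonoid Rot)

/-- The infinite dihedral group `D_z ⊆ SO(3)`. -/
def Dz : Set Rot := (Submonoid.closure (Cz ∪ {rotX π}) : Submonoid Rot)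

/-- The automorphism group `A(L, σ) ⊆ SO(3)^P` of the stabilizer code `C(L, σ)`:
all families of rotations admitting a local unitary lift mapping the code into itself. -/
def autSet (L : Submodule (ZMod 2) (QV P)) (σ : PauliSection L) : Set (P → Rot) :=
  {g | ∃ u : P → Matrix (Fin 2) (Fin 2) ℂ,
        (∀ p, u p ∈ Matrix.unitaryGroup (Fin 2) ℂ) ∧
        (∀ p, adjRot (u p) = g p) ∧
        ∀ ψ ∈ code L σ, locOp u *ᵥ ψ ∈ code L σ}

/-- The automorphism group `A(L, σ)_p` at the qubit `p`. -/
def autSetAt (L : Submodule (ZMod 2) (QV P)) (σ : PauliSection L) (p : P) : Set Rot :=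
  (fun g => g p) '' autSet L σ

/-- The normal subgroup `Z(L, σ)` of automorphisms acting by a scalar on the code. -/
def zSet (L : Submodule (ZMod 2) (QV P)) (σ : PauliSection L) : Set (P → Rot) :=
  {g | ∃ u : P → Matrix (Fin 2) (Fin 2) ℂ,
        (∀ p, u p ∈ Matrix.unitaryGroup (Fin 2) ℂ) ∧
        (∀ p, adjRot (u p) = g p) ∧
        ∃ c : ℂ, ∀ ψ ∈ code L σ, locOp u *ᵥ ψ = c • ψ}

/-! ### Restriction to subsets of qubits -/

/-- Restriction of a phase-space vector to the qubits of `S`. -/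
def resQV (S : Set P) (v : QV P) : QV ↥S := fun s => v s

/-- Restriction as a linear map. -/
def resLin (S : Set P) : QV P →ₗ[ZMod 2] QV ↥S where
  toFun := resQV S
  map_add' := by intros; rfl
  map_smul' := by intros; rfl

/-- `L_S`, regarded as a subspace of `V^S`. -/
def LSsub (L : Submodule (ZMod 2) (QV P)) (S : Set P) : Submodule (ZMod 2) (QV ↥S) :=
  Submodule.map (resLin S) (LS L S)

/-- The extension `M ⊗ 1` to `ℋ^{⊗P}` of an operator `M` on `ℋ^{⊗S}`. -/
def extendOp (S : Set P) (M : Matrix (↥S → Fin 2) (↥S → Fin 2) ℂ) : MatP P :=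
  Matrix.of fun u w =>
    if ∀ p ∉ S, u p = w p then M (fun s => u s) (fun s => w s) else 0

/-- `σ'` is the restriction `σ|_{L_S}` of the section `σ` to `L_S`. -/
def RestrictedSection (L : Submodule (ZMod 2) (QV P)) (σ : PauliSection L) (S : Set P)
    (σ' : PauliSection (LSsub L S)) : Prop :=
  ∀ v ∈ LS L S, extendOp S (σ'.toFun (resQV S v)) = σ.toFun v

/-! ### Contiguity, protected and gauge qubits, and normal forms -/

/-- Two qubits are contiguous if they are equal or `L` contains a vector supported
exactly on the pair. -/
def Contig (L : Submodule (ZMod 2) (QV P)) (p q : P) : Prop :=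
  p = q ∨ ∃ v ∈ L, supp v = ({p, q} : Set P)

/-- The contiguity class of a qubit. -/
def contigClass (L : Submodule (ZMod 2) (QV P)) (p : P) : Set P := {q | Contig L p q}

/-- The qubit `p` is protected: the projection `L → V^{{p}}` is surjective. -/
def IsProtected (L : Submodule (ZMod 2) (QV P)) (p : P) : Prop :=
  ∀ w : V, ∃ v ∈ L, v p = w

/-- The qubit `p` is of gauge type: the projection `L → V^{{p}}` has a line as image. -/
def IsGauge (L : Submodule (ZMod 2) (QV P)) (p : P) : Prop :=
  ¬ IsProtected L p ∧ ∃ v ∈ L, v p ≠ 0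

/-- The subspace `⟨z_a + z_b : a ≠ b ∈ S⟩`. -/
def zspan (S : Set P) : Submodule (ZMod 2) (QV P) :=
  Submodule.span (ZMod 2) {w | ∃ a ∈ S, ∃ b ∈ S, a ≠ b ∧ w = zvec a + zvec b}

/-- The vector `Σ_{s ∈ S} x_s`. -/
def xsumOn (S : Set P) : QV P := S.indicator fun _ => ((0 : ZMod 2), (1 : ZMod 2))

/-- Normal form of `L` (conclusion of the normalisation lemma): every contiguity class `S`
carries either `⟨z_a + z_b⟩` or `⟨z_a + z_b⟩ + ⟨Σ_{s∈S} x_s⟩`. -/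
def NormalForm (L : Submodule (ZMod 2) (QV P)) : Prop :=
  ∀ p : P,
    LS L (contigClass L p) = zspan (contigClass L p) ∨
    LS L (contigClass L p) =
      zspan (contigClass L p) ⊔ Submodule.span (ZMod 2) {xsumOn (contigClass L p)}

/-- The pair `(L, σ)` is normalised. -/
def Normalised (L : Submodule (ZMod 2) (QV P)) (σ : PauliSection L) : Prop :=
  NormalForm L ∧
  (∀ p : P, IsGauge L p → contigClass L p = {p} → ∀ v ∈ L, (v p).2 = 0) ∧
  (∀ p : P, IsProtected L p → contigClass L p = {p} →
    connectedComponentIn (autSetAt L σ p) 1 ⊆ Cz) ∧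
  (∀ p : P, IsProtected L p → contigClass L p ≠ {p} →
    LS L (contigClass L p) = zspan (contigClass L p) →
    ∃ v ∈ L, ∀ s ∈ contigClass L p, v s = ((0 : ZMod 2), (1 : ZMod 2))) ∧
  (∀ p q : P, p ≠ q → Contig L p q →
    σ.toFun (zvec p + zvec q) = Wop (zvec p + zvec q))

/-- A local symplectic family of automorphisms of `V`. -/
def IsLocalSymp (f : P → (V ≃ₗ[ZMod 2] V)) : Prop :=
  ∀ (p : P) (u v : V), omegaV (f p u) (f p v) = omegaV u v

/-- The image of `L` under a local (symplectic) transformation. -/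
def mapL (L : Submodule (ZMod 2) (QV P)) (f : P → (V ≃ₗ[ZMod 2] V)) :
    Submodule (ZMod 2) (QV P) :=
  Submodule.map (LinearEquiv.piCongrRight f : QV P ≃ₗ[ZMod 2] QV P).toLinearMap L

/-! ### Abstract group structures carried by subsets of a monoid -/

/-- The set `s` carries the structure of a solvable group. -/
structure SolvableGroupStructure (M : Type) [Monoid M] (s : Set M) where
  G : Type
  [grp : Group G]
  solv : IsSolvable G
  f : G → M
  inj : Function.Injective f
  map_mul : ∀ a b : G, f (a * b) = f a * f b
  range_eq : Set.range f = s

/-- The quotient of the group (carried by) `A` by the normal subgroup (carried by) `Z`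
is a compact solvable topological (Lie) group. -/
structure CompactSolvableQuotientStructure (M : Type) [Monoid M] [TopologicalSpace M]
    (A Z : Set M) where
  G : Type
  [grp : Group G]
  [top : TopologicalSpace G]
  [tgrp : IsTopologicalGroup G]
  cpt : CompactSpace G
  solv : IsSolvable G
  φ : M → G
  cont : ContinuousOn φ A
  map_mul' : ∀ a ∈ A, ∀ b ∈ A, φ (a * b) = φ a * φ b
  surj : ∀ y : G, ∃ a ∈ A, φ a = y
  ker : ∀ a ∈ A, (φ a = 1 ↔ a ∈ Z)

/-! ### Logical qubits and transversally realisable gates -/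

/-- The standard hermitian inner product on a finite-dimensional function space. -/
def innerF {ι : Type} [Fintype ι] (ψ φ : ι → ℂ) : ℂ := ∑ i, (starRingEnd ℂ) (ψ i) * φ i

/-- `e` is a unitary identification of the code space with a space of logical qubits. -/
def IsUnitaryEquiv (L : Submodule (ZMod 2) (QV P)) (σ : PauliSection L) {d : ℕ}
    (e : ↥(code L σ) ≃ₗ[ℂ] HP (Fin d)) : Prop :=
  ∀ ψ φ : ↥(code L σ),
    innerF (e ψ) (e φ) = innerF (ψ : HP P) (φ : HP P)

/-- The operator acting as `w` on the logical qubit `k` and trivially elsewhere. -/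
def oneQubitOp (d : ℕ) (k : Fin d) (w : Matrix (Fin 2) (Fin 2) ℂ) : MatP (Fin d) :=
  locOp fun j => if j = k then w else 1

/-- The set of rotations in `SO(3)` induced, via the identification `e`, on a fixed
logical qubit `k` by (exactly realised) transversal gates, i.e. by elements of `A(L, σ)`. -/
def logicalSet (L : Submodule (ZMod 2) (QV P)) (σ : PauliSection L) {d : ℕ}
    (e : ↥(code L σ) ≃ₗ[ℂ] HP (Fin d)) (k : Fin d) : Set Rot :=
  {A | ∃ w ∈ Matrix.unitaryGroup (Fin 2) ℂ, adjRot w = A ∧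
        ∃ u : P → Matrix (Fin 2) (Fin 2) ℂ,
          (∀ p, u p ∈ Matrix.unitaryGroup (Fin 2) ℂ) ∧
          ∀ φ : HP (Fin d),
            locOp u *ᵥ ((e.symm φ : HP P)) = ((e.symm (oneQubitOp d k w *ᵥ φ) : HP P))}

/-! ### Reed–Muller codes -/

/-- The qubit set `P = 𝔽₂^m ∖ {0}`. -/
abbrev RMQubits (m : ℕ) := {s : Fin m → ZMod 2 // s ≠ 0}

/-- Polynomial functions on `𝔽₂^m` of degree at most `r` with zero constant term. -/
def RMspan (r m : ℕ) : Submodule (ZMod 2) ((Fin m → ZMod 2) → ZMod 2) :=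
  Submodule.span (ZMod 2)
    {f | ∃ I : Finset (Fin m), I.Nonempty ∧ I.card ≤ r ∧ f = fun s => ∏ i ∈ I, s i}

/-- The shortened Reed–Muller code `R_*(r, m) ⊆ 𝔽₂^P`. -/
def RMstar (r m : ℕ) : Submodule (ZMod 2) (RMQubits m → ZMod 2) :=
  Submodule.map (LinearMap.funLeft (ZMod 2) (ZMod 2) Subtype.val) (RMspan r m)

/-- The `z`-part of a phase-space vector. -/
def zPart {P : Type} : QV P →ₗ[ZMod 2] (P → ZMod 2) where
  toFun v := fun p => (v p).1
  map_add' := by intros; rfl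
  map_smul' := by intros; rfl

/-- The `x`-part of a phase-space vector. -/
def xPart {P : Type} : QV P →ₗ[ZMod 2] (P → ZMod 2) where
  toFun v := fun p => (v p).2
  map_add' := by intros; rfl
  map_smul' := by intros; rfl

/-- The Calderbank–Shor–Steane isotropic subspace built from the shortened Reed–Muller
codes `R_*(m−2, m)` (in the `z`-coordinates) and `R_*(1, m)` (in the `x`-coordinates). -/
def cssL (m : ℕ) : Submodule (ZMod 2) (QV (RMQubits m)) :=
  Submodule.comap zPart (RMstar (m - 2) m) ⊓ Submodule.comap xPart (RMstar 1 m)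

/-- The stabilizer state `|0⟩_S ⊗ |0⟩_T + |0⟩_S ⊗ |1⟩_T + |1⟩_S ⊗ |0⟩_T − |1⟩_S ⊗ |1⟩_T`
(with `T = Sᶜ`), written in the computational basis. -/
def bellLike (S : Set P) (p q : P) : HP P := fun u =>
  if (∀ a ∈ S, u a = u p) ∧ (∀ a ∈ Sᶜ, u a = u q) then
    ((-1 : ℂ)) ^ ((u p : Fin 2).val * (u q : Fin 2).val) else 0


section ProjectionToSubsets

open scoped Kronecker ComplexOrder

/-! ### Local operators -/

lemma locOp_mul (g h : P → Matrix (Fin 2) (Fin 2) ℂ) :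
    locOp g * locOp h = locOp fun p => g p * h p := by
  ext a b
  simp only [locOp, Matrix.mul_apply, Matrix.of_apply, ← Finset.prod_mul_distrib]
  rw [Finset.prod_univ_sum, Fintype.piFinset_univ]

lemma locOp_one : locOp (fun _ : P => (1 : Matrix (Fin 2) (Fin 2) ℂ)) = 1 := by
  ext a b
  simp only [locOp, Matrix.of_apply, Matrix.one_apply]
  by_cases h : a = b
  · simp [h]
  · obtain ⟨p, hp⟩ := Function.ne_iff.mp h
    rw [if_neg h]
    exact Finset.prod_eq_zero (Finset.mem_univ p) (if_neg hp)

lemma conjTranspose_locOp (g : P → Matrix (Fin 2) (Fin 2) ℂ) :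
    (locOp g)ᴴ = locOp fun p => (g p)ᴴ := by
  ext a b
  simp [locOp, Matrix.conjTranspose_apply]

lemma trace_locOp (g : P → Matrix (Fin 2) (Fin 2) ℂ) :
    (locOp g).trace = ∏ p, (g p).trace := by
  simp only [locOp, Matrix.trace, Matrix.diag_apply, Matrix.of_apply]
  rw [Finset.prod_univ_sum, Fintype.piFinset_univ]

lemma conjTranspose_locOp_mul_self {u : P → Matrix (Fin 2) (Fin 2) ℂ}
    (hu : ∀ p, u p ∈ Matrix.unitaryGroup (Fin 2) ℂ) : (locOp u)ᴴ * locOp u = 1 := by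
  rw [conjTranspose_locOp, locOp_mul, ← locOp_one]
  congr 1
  funext p
  exact Matrix.mem_unitaryGroup_iff'.mp (hu p)

lemma trace_pauliMat {v : V} (hv : v ≠ 0) : (pauliMat v).trace = 0 := by
  obtain ⟨a, b⟩ := v
  fin_cases a <;> fin_cases b
  · exact absurd rfl hv
  all_goals simp [pauliMat, sigmaX, sigmaZ, Matrix.trace_fin_two, ZMod.val]

/-! ### Tensor decomposition along a subset of qubits -/

lemma locOp_eq_kronecker (S : Set P) (g : P → Matrix (Fin 2) (Fin 2) ℂ) :
    locOp g = (locOp (fun s : ↥S => g s) ⊗ₖ locOp (fun t : {p // ¬ p ∈ S} => g t)).submatrix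
      (Equiv.piEquivPiSubtypeProd (· ∈ S) fun _ => Fin 2)
      (Equiv.piEquivPiSubtypeProd (· ∈ S) fun _ => Fin 2) := by
  ext a b
  simp only [locOp, Matrix.of_apply, Matrix.submatrix_apply, Matrix.kroneckerMap_apply,
    Equiv.piEquivPiSubtypeProd_apply]
  exact (Fintype.prod_subtype_mul_prod_subtype (· ∈ S) fun p => g p (a p) (b p)).symm

lemma extendOp_eq_kronecker (S : Set P) (M : Matrix (↥S → Fin 2) (↥S → Fin 2) ℂ) :
    extendOp S M = (M ⊗ₖ (1 : MatP {p // ¬ p ∈ S})).submatrix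
      (Equiv.piEquivPiSubtypeProd (· ∈ S) fun _ => Fin 2)
      (Equiv.piEquivPiSubtypeProd (· ∈ S) fun _ => Fin 2) := by
  ext a b
  simp [extendOp, Matrix.one_apply, funext_iff]

lemma trace_submatrix_equiv {m n : Type*} [Fintype m] [Fintype n] (A : Matrix n n ℂ)
    (e : m ≃ n) : (A.submatrix e e).trace = A.trace :=
  e.sum_comp fun i => A i i

lemma extendOp_mul (S : Set P) (A B : Matrix (↥S → Fin 2) (↥S → Fin 2) ℂ) :
    extendOp S A * extendOp S B = extendOp S (A * B) := by
  simp only [extendOp_eq_kronecker]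
  rw [Matrix.submatrix_mul_equiv, ← Matrix.mul_kronecker_mul, one_mul]

lemma trace_extendOp (S : Set P) (A : Matrix (↥S → Fin 2) (↥S → Fin 2) ℂ) :
    (extendOp S A).trace = A.trace * Fintype.card ({p // ¬ p ∈ S} → Fin 2) := by
  rw [extendOp_eq_kronecker, trace_submatrix_equiv, Matrix.trace_kronecker, Matrix.trace_one]

lemma trace_locOp_mul_extendOp (S : Set P) (g : P → Matrix (Fin 2) (Fin 2) ℂ)
    (A : Matrix (↥S → Fin 2) (↥S → Fin 2) ℂ) :
    (locOp g * extendOp S A).trace =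
      (locOp (fun s : ↥S => g s) * A).trace * ∏ t : {p // ¬ p ∈ S}, (g t).trace := by
  rw [locOp_eq_kronecker S, extendOp_eq_kronecker, Matrix.submatrix_mul_equiv,
    ← Matrix.mul_kronecker_mul, trace_submatrix_equiv, Matrix.trace_kronecker, mul_one,
    trace_locOp]

lemma conjTranspose_locOp_mul_extendOp_mul_locOp (S : Set P)
    {u : P → Matrix (Fin 2) (Fin 2) ℂ} (hu : ∀ p, u p ∈ Matrix.unitaryGroup (Fin 2) ℂ)
    (A : Matrix (↥S → Fin 2) (↥S → Fin 2) ℂ) :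
    (locOp u)ᴴ * extendOp S A * locOp u =
      extendOp S ((locOp fun s : ↥S => u s)ᴴ * A * locOp fun s : ↥S => u s) := by
  rw [locOp_eq_kronecker S u, extendOp_eq_kronecker, extendOp_eq_kronecker,
    Matrix.conjTranspose_submatrix, Matrix.submatrix_mul_equiv, Matrix.submatrix_mul_equiv,
    Matrix.conjTranspose_kronecker, ← Matrix.mul_kronecker_mul, ← Matrix.mul_kronecker_mul,
    mul_one, conjTranspose_locOp_mul_self fun t : {p // ¬ p ∈ S} => hu t]

/-! ### The sum of the stabilizer group -/

/-- The sum of the stabilizer group, a multiple of the orthogonal projection onto the code. -/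
def stabSum (L : Submodule (ZMod 2) (QV P)) (σ : PauliSection L) : MatP P :=
  ∑ v : QV P with v ∈ L, σ.toFun v

/-- The number of elements of `L`, as a complex number. -/
def cardL (L : Submodule (ZMod 2) (QV P)) : ℂ :=
  (Finset.card {v : QV P | v ∈ L} : ℕ)

variable {L : Submodule (ZMod 2) (QV P)} {σ : PauliSection L}

lemma cardL_ne_zero : cardL L ≠ 0 := by
  rw [cardL, Nat.cast_ne_zero, Finset.card_ne_zero]
  exact ⟨0, by simp⟩

lemma star_cardL : star (cardL L) = cardL L := by
  simp [cardL]

lemma toFun_mul_stabSum {v : QV P} (hv : v ∈ L) :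
    σ.toFun v * stabSum L σ = stabSum L σ := by
  rw [stabSum, Finset.mul_sum]
  refine Finset.sum_equiv (Equiv.addLeft v) (fun w => ?_) fun w hw => ?_
  · simp [L.add_mem_iff_right hv]
  · exact (σ.mul_of_mem v hv w (by simpa using hw)).symm

lemma conjTranspose_toFun {v : QV P} (hv : v ∈ L) : (σ.toFun v)ᴴ = σ.toFun v := by
  have h : σ.toFun v * σ.toFun v = 1 := by
    rw [← σ.mul_of_mem v hv v hv, ZModModule.add_self, σ.map_zero]
  have h' : (σ.toFun v)ᴴ * σ.toFun v = 1 := Matrix.mem_unitaryGroup_iff'.mp (σ.unitary v)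
  rw [← mul_one (σ.toFun v)ᴴ, ← h, ← mul_assoc, h', one_mul]

lemma conjTranspose_stabSum : (stabSum L σ)ᴴ = stabSum L σ := by
  rw [stabSum, Matrix.conjTranspose_sum]
  exact Finset.sum_congr rfl fun v hv => conjTranspose_toFun (by simpa using hv)

lemma stabSum_mulVec_mem (ψ : HP P) : stabSum L σ *ᵥ ψ ∈ code L σ := fun v hv => by
  rw [Matrix.mulVec_mulVec, toFun_mul_stabSum hv]

lemma stabSum_mulVec_of_mem {ψ : HP P} (hψ : ψ ∈ code L σ) :
    stabSum L σ *ᵥ ψ = cardL L • ψ := by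
  rw [stabSum, Matrix.sum_mulVec, Finset.sum_congr rfl fun v hv => hψ v (by simpa using hv),
    Finset.sum_const, cardL, Nat.cast_smul_eq_nsmul]

lemma stabSum_mul_of_preserves {M : MatP P} (hM : ∀ ψ ∈ code L σ, M *ᵥ ψ ∈ code L σ) :
    stabSum L σ * (M * stabSum L σ) = cardL L • (M * stabSum L σ) := by
  refine Matrix.ext_of_mulVec_single fun i => ?_
  rw [← Matrix.mulVec_mulVec, Matrix.smul_mulVec, ← Matrix.mulVec_mulVec]
  exact stabSum_mulVec_of_mem (hM _ (stabSum_mulVec_mem _))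

lemma stabSum_mul_self : stabSum L σ * stabSum L σ = cardL L • stabSum L σ := by
  simpa using stabSum_mul_of_preserves (σ := σ) (M := 1) (by simp)

/-- A Hermitian multiple of a projection dominated by another one of the same trace
is equal to it. -/
lemma eq_of_trace_eq {n : Type*} [Fintype n] {T A : Matrix n n ℂ} {c : ℂ} (hc : star c = c)
    (hT : Tᴴ = T) (hA : Aᴴ = A) (hTT : T * T = c • T) (hAA : A * A = c • A)
    (hTA : T * A = c • A) (htr : A.trace = T.trace) : A = T := by
  have hAT : A * T = c • A := by
    simpa [hT, hA, hc] using congrArg Matrix.conjTranspose hTA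
  have h : ((A - T)ᴴ * (A - T)).trace = 0 := by
    rw [Matrix.conjTranspose_sub, hT, hA, sub_mul, mul_sub, mul_sub, hAA, hAT, hTA, hTT]
    simp [htr]
  exact sub_eq_zero.mp (Matrix.trace_conjTranspose_mul_self_eq_zero_iff.mp h)

lemma mul_stabSum_mul_conjTranspose {U : MatP P} (hU : Uᴴ * U = 1)
    (h : ∀ ψ ∈ code L σ, U *ᵥ ψ ∈ code L σ) :
    U * stabSum L σ * Uᴴ = stabSum L σ := by
  refine eq_of_trace_eq (c := cardL L) star_cardL conjTranspose_stabSum ?_ stabSum_mul_self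
    ?_ ?_ ?_
  · simp [conjTranspose_stabSum, mul_assoc]
  · calc U * stabSum L σ * Uᴴ * (U * stabSum L σ * Uᴴ)
        = U * stabSum L σ * (Uᴴ * U) * (stabSum L σ * Uᴴ) := by simp only [mul_assoc]
      _ = U * (stabSum L σ * stabSum L σ) * Uᴴ := by rw [hU]; simp only [mul_assoc, one_mul]
      _ = cardL L • (U * stabSum L σ * Uᴴ) := by
        rw [stabSum_mul_self, Matrix.mul_smul, Matrix.smul_mul]
  · rw [← mul_assoc, stabSum_mul_of_preserves h, Matrix.smul_mul]
  · rw [Matrix.trace_mul_comm, ← mul_assoc, hU, one_mul]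

lemma mulVec_mem_code_of_commute {U : MatP P} (h : U * stabSum L σ = stabSum L σ * U)
    {ψ : HP P} (hψ : ψ ∈ code L σ) : U *ᵥ ψ ∈ code L σ := by
  have h' : stabSum L σ *ᵥ (U *ᵥ ψ) = cardL L • (U *ᵥ ψ) := by
    rw [Matrix.mulVec_mulVec, ← h, ← Matrix.mulVec_mulVec, stabSum_mulVec_of_mem hψ,
      Matrix.mulVec_smul]
  rw [← inv_smul_smul₀ (cardL_ne_zero (L := L)) (U *ᵥ ψ), ← h']
  exact Submodule.smul_mem _ _ (stabSum_mulVec_mem _)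

/-! ### Restriction to a subset of qubits -/

lemma trace_toFun_mul_extendOp (S : Set P) {v : QV P} (hv : v ∉ coordSub S)
    (A : Matrix (↥S → Fin 2) (↥S → Fin 2) ℂ) : (σ.toFun v * extendOp S A).trace = 0 := by
  obtain ⟨p, hp, hvp⟩ : ∃ p, p ∉ S ∧ v p ≠ 0 := by
    by_contra! h
    exact hv h
  obtain ⟨c, hc⟩ := σ.scalar v
  rw [hc, Matrix.smul_mul, Matrix.trace_smul, Wop, trace_locOp_mul_extendOp,
    Finset.prod_eq_zero (Finset.mem_univ (⟨p, hp⟩ : {p // ¬ p ∈ S})) (trace_pauliMat hvp),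
    mul_zero, smul_zero]

lemma resQV_injOn (S : Set P) : Set.InjOn (resQV S) (coordSub S : Set (QV P)) := by
  intro v hv w hw h
  funext p
  by_cases hp : p ∈ S
  · exact congrFun h ⟨p, hp⟩
  · rw [hv p hp, hw p hp]

lemma trace_stabSum_mul_extendOp {S : Set P} {σ' : PauliSection (LSsub L S)}
    (hσ' : RestrictedSection L σ S σ') (A : Matrix (↥S → Fin 2) (↥S → Fin 2) ℂ) :
    (stabSum L σ * extendOp S A).trace =
      (stabSum (LSsub L S) σ' * A).trace * Fintype.card ({p // ¬ p ∈ S} → Fin 2) := by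
  have hsub : ∑ v : QV P with v ∈ LS L S, (σ.toFun v * extendOp S A).trace =
      ∑ v : QV P with v ∈ L, (σ.toFun v * extendOp S A).trace := by
    refine Finset.sum_subset (fun v hv => ?_) fun v hv hv' => ?_
    · simp only [Finset.mem_filter_univ] at hv ⊢
      exact hv.1
    · simp only [Finset.mem_filter_univ] at hv hv'
      exact trace_toFun_mul_extendOp S (fun h => hv' ⟨hv, h⟩) A
  rw [stabSum, stabSum, Finset.sum_mul, Finset.sum_mul, Matrix.trace_sum, Matrix.trace_sum,
    ← hsub, Finset.sum_mul]
  refine Finset.sum_bij (fun v _ => resQV S v) (fun v hv => ?_) (fun v hv w hw h => ?_)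
    (fun w hw => ?_) fun v hv => ?_
  · simp only [Finset.mem_filter_univ] at hv ⊢
    exact Submodule.mem_map_of_mem (f := resLin S) hv
  · simp only [Finset.mem_filter_univ] at hv hw
    exact resQV_injOn S hv.2 hw.2 h
  · simp only [Finset.mem_filter_univ] at hw
    obtain ⟨v, hv, rfl⟩ := Submodule.mem_map.mp hw
    exact ⟨v, by simpa using hv, rfl⟩
  · simp only [Finset.mem_filter_univ] at hv
    rw [← hσ' v hv, extendOp_mul, trace_extendOp]

lemma stabSum_conj_of_restricted {S : Set P} {σ' : PauliSection (LSsub L S)}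
    (hσ' : RestrictedSection L σ S σ') {u : P → Matrix (Fin 2) (Fin 2) ℂ}
    (hu : ∀ p, u p ∈ Matrix.unitaryGroup (Fin 2) ℂ)
    (h : locOp u * stabSum L σ * (locOp u)ᴴ = stabSum L σ) :
    (locOp fun s : ↥S => u s) * stabSum (LSsub L S) σ' * (locOp fun s : ↥S => u s)ᴴ =
      stabSum (LSsub L S) σ' := by
  refine Matrix.ext_iff_trace_mul_right.mpr fun A => ?_
  have hcard : (Fintype.card ({p // ¬ p ∈ S} → Fin 2) : ℂ) ≠ 0 :=
    Nat.cast_ne_zero.mpr Fintype.card_ne_zero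
  refine mul_right_cancel₀ hcard ?_
  rw [mul_assoc, mul_assoc, Matrix.trace_mul_comm, mul_assoc,
    ← trace_stabSum_mul_extendOp hσ', ← trace_stabSum_mul_extendOp hσ',
    ← conjTranspose_locOp_mul_extendOp_mul_locOp S hu]
  conv_rhs => rw [← h, mul_assoc, mul_assoc, Matrix.trace_mul_comm, mul_assoc]

end ProjectionToSubsets

/-- **Lemma (projection to subsets).** Let `L ⊆ V^P` be isotropic, `σ` a section over `L`,
and `S ⊆ P` a subset. Then the Cartesian projection `SO(3)^P → SO(3)^S` sends
`A(L, σ)` into `A(L_S, σ|_{L_S})`. -/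
theorem projection_to_subsets {P : Type} [Fintype P] [DecidableEq P]
    (L : Submodule (ZMod 2) (QV P)) (hL : Isotropic L) (σ : PauliSection L)
    (S : Set P) (σ' : PauliSection (LSsub L S)) (hσ' : RestrictedSection L σ S σ')
    (g : P → Rot) (hg : g ∈ autSet L σ) :
    (fun s : ↥S => g ↑s) ∈ autSet (LSsub L S) σ' := by
  obtain ⟨u, hu, hug, hcode⟩ := hg
  have hu' : ∀ s : ↥S, u s ∈ Matrix.unitaryGroup (Fin 2) ℂ := fun s => hu s
  have hconj := stabSum_conj_of_restricted hσ' hu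
    (mul_stabSum_mul_conjTranspose (conjTranspose_locOp_mul_self hu) hcode)
  refine ⟨fun s => u s, hu', fun s => hug s, fun ψ hψ => mulVec_mem_code_of_commute ?_ hψ⟩
  conv_rhs => rw [← hconj, mul_assoc, conjTranspose_locOp_mul_self hu', mul_one]

end Stab
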